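/- Let n≥1 be an integer, q > 0, and let I = (i_1,…,i_k) be an increasing sequence of indices in {1,…,n}. Let b be an integer with 1 ≤ b ≤ n − i_k and let I+b = (i_1+b,…,i_k+b). If π is distributed according to the (n,q)-Mallows measure, then the induced orderings π_I and π_{I+b} have the same distribution: for every ω ∈ S_k, P(π_I = ω) = P(π_{I+b} = ω). -/

import Mathlib

open Finset

/-- Number of inversions of a permutation of `Fin n`. -/
def mallowsInv {n : ℕ} (π : Equiv.Perm (Fin n)) : ℕ :=
  (Finset.univ.filter (fun p : Fin n × Fin n => p.1 < p.2 ∧ π p.2 < π p.1)).card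

/-- The `(n,q)`-Mallows probability mass function on `S_n`. -/
noncomputable def mallowsPMF (n : ℕ) (q : ℝ) (π : Equiv.Perm (Fin n)) : ℝ :=
  q ^ mallowsInv π / ∑ σ : Equiv.Perm (Fin n), q ^ mallowsInv σ

/-- Probability of an event under the `(n,q)`-Mallows measure. -/
noncomputable def mallowsProb (n : ℕ) (q : ℝ) (A : Set (Equiv.Perm (Fin n))) : ℝ :=
  ∑ π : Equiv.Perm (Fin n), A.indicator (mallowsPMF n q) π

/-- Expectation of a function under the `(n,q)`-Mallows measure. -/
noncomputable def mallowsExp (n : ℕ) (q : ℝ) (f : Equiv.Perm (Fin n) → ℝ) : ℝ :=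
  ∑ π : Equiv.Perm (Fin n), mallowsPMF n q π * f π

/-- Length of the longest increasing subsequence of a permutation of `Fin n`. -/
noncomputable def LIS {n : ℕ} (π : Equiv.Perm (Fin n)) : ℕ :=
  sSup {m | ∃ f : Fin m → Fin n, StrictMono f ∧ StrictMono (fun j => π (f j))}

/-- Length of the longest decreasing subsequence of a permutation of `Fin n`. -/
noncomputable def LDS {n : ℕ} (π : Equiv.Perm (Fin n)) : ℕ :=
  sSup {m | ∃ f : Fin m → Fin n, StrictMono f ∧ StrictAnti (fun j => π (f j))}

/-- The permutation of `Fin (m + 1)` sending `v` to `v.rev` and increasing away from `v`. -/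
def moveToRev {m : ℕ} (v : Fin (m + 1)) : Equiv.Perm (Fin (m + 1)) :=
  (finSuccEquiv' v).trans (finSuccEquiv' v.rev).symm

theorem moveToRev_self {m : ℕ} (v : Fin (m + 1)) : moveToRev v v = v.rev := by
  simp [moveToRev]

theorem moveToRev_lt_iff {m : ℕ} {v x y : Fin (m + 1)} (hx : x ≠ v) (hy : y ≠ v) :
    moveToRev v x < moveToRev v y ↔ x < y := by
  obtain ⟨a, rfl⟩ := Fin.exists_succAbove_eq hx
  obtain ⟨c, rfl⟩ := Fin.exists_succAbove_eq hy
  simp [moveToRev]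

/-- Delete the first entry `v` of the one-line notation of a permutation and append `v.rev`
at the end, keeping the relative order of the other entries. -/
def cycleEntries {m : ℕ} (π : Equiv.Perm (Fin (m + 1))) : Equiv.Perm (Fin (m + 1)) :=
  ((finRotate (m + 1)).trans π).trans (moveToRev (π 0))

theorem cycleEntries_last {m : ℕ} (π : Equiv.Perm (Fin (m + 1))) :
    cycleEntries π (Fin.last m) = (π 0).rev := by
  simp [cycleEntries, moveToRev_self]

theorem cycleEntries_castSucc {m : ℕ} (π : Equiv.Perm (Fin (m + 1))) (i : Fin m) :
    cycleEntries π i.castSucc = moveToRev (π 0) (π i.succ) := by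
  simp [cycleEntries]

theorem cycleEntries_castSucc_lt_iff {m : ℕ} (π : Equiv.Perm (Fin (m + 1))) (i j : Fin m) :
    cycleEntries π i.castSucc < cycleEntries π j.castSucc ↔ π i.succ < π j.succ := by
  rw [cycleEntries_castSucc, cycleEntries_castSucc]
  exact moveToRev_lt_iff (π.injective.ne (Fin.succ_ne_zero i))
    (π.injective.ne (Fin.succ_ne_zero j))

theorem cycleEntries_bijective (m : ℕ) :
    Function.Bijective (cycleEntries : Equiv.Perm (Fin (m + 1)) → _) := by
  refine Finite.injective_iff_bijective.mp fun π σ h => ?_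
  have h0 : π 0 = σ 0 := by
    have := congrArg (fun τ => τ (Fin.last m)) h
    simpa [cycleEntries_last] using this
  ext1 x
  have := congrArg (fun τ => τ ((finRotate (m + 1)).symm x)) h
  simpa [cycleEntries, h0] using this

theorem sum_ite_apply_lt {n : ℕ} (π : Equiv.Perm (Fin n)) (v : Fin n) :
    ∑ j, (if π j < v then 1 else 0) = (v : ℕ) := by
  rw [Equiv.sum_comp π (fun x => if x < v then 1 else 0), ← Finset.card_filter]
  simp [Finset.filter_gt_eq_Iio]

theorem sum_ite_lt_apply {n : ℕ} (π : Equiv.Perm (Fin n)) (v : Fin n) :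
    ∑ j, (if v < π j then 1 else 0) = (v.rev : ℕ) := by
  rw [Equiv.sum_comp π (fun x => if v < x then 1 else 0), ← Finset.card_filter]
  simp [Finset.filter_lt_eq_Ioi, Fin.val_rev]
  omega

theorem mallowsInv_eq_sum {n : ℕ} (π : Equiv.Perm (Fin n)) :
    mallowsInv π = ∑ i, ∑ j, if i < j ∧ π j < π i then 1 else 0 := by
  rw [mallowsInv, Finset.card_filter, Fintype.sum_prod_type]

theorem mallowsInv_eq_add_first {m : ℕ} (π : Equiv.Perm (Fin (m + 1))) :
    mallowsInv π = (π 0 : ℕ) +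
      ∑ i : Fin m, ∑ j : Fin m, if i < j ∧ π j.succ < π i.succ then 1 else 0 := by
  rw [mallowsInv_eq_sum, Fin.sum_univ_succ, ← sum_ite_apply_lt π (π 0)]
  simp [Fin.sum_univ_succ, -Finset.sum_boole]

theorem mallowsInv_eq_add_last {m : ℕ} (π : Equiv.Perm (Fin (m + 1))) :
    mallowsInv π = ((π (Fin.last m)).rev : ℕ) +
      ∑ i : Fin m, ∑ j : Fin m, if i < j ∧ π j.castSucc < π i.castSucc then 1 else 0 := by
  rw [mallowsInv_eq_sum, ← sum_ite_lt_apply π (π (Fin.last m))]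
  simp [Fin.sum_univ_castSucc, Finset.sum_add_distrib, (Fin.castSucc_lt_last _).not_gt,
    add_comm, -Finset.sum_boole]

theorem mallowsInv_cycleEntries {m : ℕ} (π : Equiv.Perm (Fin (m + 1))) :
    mallowsInv (cycleEntries π) = mallowsInv π := by
  rw [mallowsInv_eq_add_last, mallowsInv_eq_add_first, cycleEntries_last, Fin.rev_rev]
  simp only [cycleEntries_castSucc_lt_iff]

theorem mallowsProb_preimage_cycleEntries (m : ℕ) (q : ℝ)
    (A : Set (Equiv.Perm (Fin (m + 1)))) :
    mallowsProb (m + 1) q (cycleEntries ⁻¹' A) = mallowsProb (m + 1) q A := by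
  rw [mallowsProb, mallowsProb,
    ← (cycleEntries_bijective m).sum_comp (A.indicator (mallowsPMF (m + 1) q))]
  refine Finset.sum_congr rfl fun π _ => ?_
  classical
  simp only [Set.indicator_apply, Set.mem_preimage, mallowsPMF, mallowsInv_cycleEntries]

theorem mallowsProb_inducedOrdering_shift (m : ℕ) (q : ℝ) {k : ℕ} (I : Fin k → Fin (m + 1))
    (R : Fin k → Fin k → Prop) (b : ℕ) (hb : ∀ j, (I j : ℕ) + b < m + 1) :
    mallowsProb (m + 1) q {π | ∀ j l, (R l j ↔ π (I l) < π (I j))} =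
    mallowsProb (m + 1) q
      {π | ∀ j l, (R l j ↔ π ⟨(I l : ℕ) + b, hb l⟩ < π ⟨(I j : ℕ) + b, hb j⟩)} := by
  induction b with
  | zero => rfl
  | succ b ih =>
    rw [ih fun j => by have := hb j; omega, ← mallowsProb_preimage_cycleEntries]
    congr 1
    ext π
    refine forall₂_congr fun j l => iff_congr Iff.rfl ?_
    exact cycleEntries_castSucc_lt_iff π ⟨I l + b, by have := hb l; omega⟩
      ⟨I j + b, by have := hb j; omega⟩

/-- translation invariance of induced orderings: For `π ~ μ_{n,q}`, an
increasing sequence of indices `I = (i_1,…,i_k)` and `1 ≤ b ≤ n − i_k`, the induced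
relative orderings `π_I` and `π_{I+b}` have the same distribution: for every `ω ∈ S_k`,
`P(π_I = ω) = P(π_{I+b} = ω)`. The event `{π_I = ω}` is expressed by its defining
property `ω(j) > ω(l) ↔ π(i_j) > π(i_l)` for all `j,l`. -/
theorem mallows_induced_ordering_translation_invariance (n : ℕ) (hn : 1 ≤ n) (q : ℝ)
    (hq : 0 < q) (k : ℕ) (I : Fin k → Fin n) (hI : StrictMono I)
    (b : ℕ) (hb1 : 1 ≤ b) (hb : ∀ j : Fin k, (I j : ℕ) + b < n)
    (ω : Equiv.Perm (Fin k)) :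
    mallowsProb n q {π | ∀ j l : Fin k, (ω l < ω j ↔ π (I l) < π (I j))} =
    mallowsProb n q
      {π | ∀ j l : Fin k, (ω l < ω j ↔ π ⟨(I l : ℕ) + b, hb l⟩ < π ⟨(I j : ℕ) + b, hb j⟩)} := by
  obtain ⟨m, rfl⟩ := Nat.exists_eq_succ_of_ne_zero (Nat.one_le_iff_ne_zero.mp hn)
  exact mallowsProb_inducedOrdering_shift m q I (fun l j => ω l < ω j) b hb
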